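/- Let A ⊂ ℝ be a finite nonempty set with T = #A, let Ψ > 0 be a real number, and let r ≥ 1 be an integer. Let ν be the absolutely continuous Borel measure on ℝ with density g(x) = (Ψ/T)·∑_{a ∈ A} 1_{[a, a+1/Ψ)}(x), so that ν is a probability measure. Then there is a constant C_r > 0 depending only on r (namely C_r = (1_{[−1/2,1/2)})^{*2r}(0), the value at 0 of the 2r-fold convolution of the indicator of [−1/2,1/2)) such that ∫_ℝ |ν̂(ξ)|^{2r} dξ ≥ C_r · (Ψ / T^{2r}) · M_r, where M_r = #{ (a₁, …, a_{2r}) ∈ A^{2r} : a₁ + ⋯ + a_r = a_{r+1} + ⋯ + a_{2r} }. -/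

import Mathlib

open MeasureTheory

/-- The `(n+1)`-fold self-convolution of `f : ℝ → ℝ`: `convIter f 0 = f` and
`convIter f (n+1) = (convIter f n) ⋆ f`. -/
noncomputable def convIter (f : ℝ → ℝ) : ℕ → (ℝ → ℝ)
  | 0 => f
  | n + 1 => convolution (convIter f n) f (ContinuousLinearMap.lsmul ℝ ℝ) volume


open FourierTransform

/-- The indicator of the centred unit interval. -/
noncomputable def salemF : ℝ → ℝ := Set.indicator (Set.Ico (-(1 : ℝ) / 2) (1 / 2)) 1

lemma salemF_nonneg (x : ℝ) : 0 ≤ salemF x :=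
  Set.indicator_nonneg (fun _ _ => zero_le_one) x

lemma salemF_integrable : Integrable salemF := by
  unfold salemF
  rw [integrable_indicator_iff measurableSet_Ico]
  exact integrableOn_const (by simp) (by simp)

lemma convIter_succ_apply (n : ℕ) (x : ℝ) :
    convIter salemF (n + 1) x = ∫ t, convIter salemF n t * salemF (x - t) := by
  simp [convIter, convolution]

lemma convIter_nonneg (n : ℕ) (x : ℝ) : 0 ≤ convIter salemF n x := by
  induction n generalizing x with
  | zero => exact salemF_nonneg x
  | succ n ih =>
    rw [convIter_succ_apply]
    exact integral_nonneg fun t => mul_nonneg (ih t) (salemF_nonneg _)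

lemma convIter_integrable (n : ℕ) : Integrable (convIter salemF n) := by
  induction n with
  | zero => exact salemF_integrable
  | succ n ih => exact ih.integrable_convolution _ salemF_integrable

lemma convIter_continuous (n : ℕ) : Continuous (convIter salemF (n + 1)) := by
  have hint := convIter_integrable n
  have h : ∀ x, convIter salemF (n + 1) x =
      (∫ t in (0 : ℝ)..(x + 1 / 2), convIter salemF n t)
        - ∫ t in (0 : ℝ)..(x - 1 / 2), convIter salemF n t := by
    intro x
    rw [convIter_succ_apply, intervalIntegral.integral_interval_sub_left
      hint.intervalIntegrable hint.intervalIntegrable,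
      intervalIntegral.integral_of_le (by linarith), ← integral_indicator measurableSet_Ioc]
    congr 1
    ext t
    unfold salemF
    by_cases ht : t ∈ Set.Ioc (x - 1 / 2) (x + 1 / 2)
    · rw [Set.indicator_of_mem ht, Set.indicator_of_mem]
      · simp
      · constructor <;> linarith [ht.1, ht.2]
    · rw [Set.indicator_of_notMem ht, Set.indicator_of_notMem]
      · simp
      · intro h
        exact ht ⟨by linarith [h.2], by linarith [h.1]⟩
  rw [funext h]
  have hc := intervalIntegral.continuous_primitive
    (f := convIter salemF n) (fun a b => hint.intervalIntegrable) 0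
  exact (hc.comp (by fun_prop)).sub (hc.comp (by fun_prop))

lemma exp_integral (c h ξ : ℝ) :
    ∫ x in (c - h)..(c + h), Complex.exp (-(2 * (Real.pi : ℂ) * Complex.I * (ξ : ℂ) * (x : ℂ)))
      = Complex.exp (-(2 * (Real.pi : ℂ) * Complex.I * (ξ : ℂ) * (c : ℂ)))
        * ((2 * h * Real.sinc (2 * Real.pi * ξ * h) : ℝ) : ℂ) := by
  have h1 : ∫ x in (c - h)..(c + h),
        Complex.exp (-(2 * (Real.pi : ℂ) * Complex.I * (ξ : ℂ) * (x : ℂ)))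
      = ∫ x in (-h)..h,
        Complex.exp (-(2 * (Real.pi : ℂ) * Complex.I * (ξ : ℂ) * ((x + c : ℝ) : ℂ))) := by
    rw [intervalIntegral.integral_comp_add_right
      (fun x : ℝ => Complex.exp (-(2 * (Real.pi : ℂ) * Complex.I * (ξ : ℂ) * (x : ℂ))))]
    congr 1 <;> ring
  rw [h1]
  have h2 : ∀ x : ℝ, Complex.exp (-(2 * (Real.pi : ℂ) * Complex.I * (ξ : ℂ) * ((x + c : ℝ) : ℂ)))
      = Complex.exp (-(2 * (Real.pi : ℂ) * Complex.I * (ξ : ℂ) * (c : ℂ)))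
        * Complex.exp (((-(2 * Real.pi * ξ) * x : ℝ) : ℂ) * Complex.I) := by
    intro x
    rw [← Complex.exp_add]
    congr 1
    push_cast
    ring
  simp_rw [h2]
  rw [intervalIntegral.integral_const_mul]
  congr 1
  by_cases hξ : ξ = 0
  · subst hξ
    simp
    ring
  have hk : -(2 * Real.pi * ξ) ≠ 0 := by
    have := Real.pi_ne_zero
    simp [hξ]
  rw [intervalIntegral.integral_comp_mul_left (fun x : ℝ => Complex.exp ((x : ℂ) * Complex.I)) hk,
    mul_neg, integral_exp_mul_I_eq_sinc, neg_mul, Real.sinc_neg, Complex.real_smul]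
  have hξ' : (ξ : ℂ) ≠ 0 := by exact_mod_cast hξ
  have hpi : (Real.pi : ℂ) ≠ 0 := by exact_mod_cast Real.pi_ne_zero
  push_cast
  field_simp

lemma fourier_salemF (ξ : ℝ) :
    𝓕 (fun x => (salemF x : ℂ)) ξ = (Real.sinc (Real.pi * ξ) : ℂ) := by
  rw [Real.fourier_real_eq_integral_exp_smul]
  have h := exp_integral 0 (1 / 2) ξ
  rw [intervalIntegral.integral_of_le (by norm_num), ← integral_Ico_eq_integral_Ioc,
    ← integral_indicator measurableSet_Ico] at h
  have e : (2 * (1 / 2) * Real.sinc (2 * Real.pi * ξ * (1 / 2)) : ℝ)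
      = Real.sinc (Real.pi * ξ) := by
    rw [show 2 * Real.pi * ξ * (1 / 2) = Real.pi * ξ by ring]; ring
  rw [e] at h
  simp only [Complex.ofReal_zero, mul_zero, neg_zero, Complex.exp_zero, one_mul] at h
  rw [← h]
  congr 1
  ext x
  unfold salemF
  have hs : Set.Ico (-(1 : ℝ) / 2) (1 / 2) = Set.Ico (0 - 1 / 2) (0 + 1 / 2) := by
    congr 1 <;> norm_num
  rw [hs]
  by_cases hx : x ∈ Set.Ico ((0 : ℝ) - 1 / 2) (0 + 1 / 2)
  · rw [Set.indicator_of_mem hx, Set.indicator_of_mem hx]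
    simp only [Pi.one_apply, Complex.ofReal_one, smul_eq_mul, mul_one]
    congr 1
    push_cast
    ring
  · rw [Set.indicator_of_notMem hx, Set.indicator_of_notMem hx]
    simp

lemma fourier_convIter (n : ℕ) (ξ : ℝ) :
    𝓕 (fun x => (convIter salemF n x : ℂ)) ξ = ((Real.sinc (Real.pi * ξ) ^ (n + 1) : ℝ) : ℂ) := by
  induction n with
  | zero => simpa [convIter] using fourier_salemF ξ
  | succ n ih =>
    have h : (fun x => (convIter salemF (n + 1) x : ℂ)) =
        convolution (fun x => (convIter salemF n x : ℂ)) (fun x => (salemF x : ℂ))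
          (ContinuousLinearMap.lsmul ℂ ℂ) volume := by
      ext x
      rw [convIter_succ_apply, ← integral_complex_ofReal]
      simp [convolution]
    have h1 : Integrable (fun x => (convIter salemF n x : ℂ)) := (convIter_integrable n).ofReal
    have h2 : Integrable (fun x => (salemF x : ℂ)) := salemF_integrable.ofReal
    have h3 := Real.fourier_smul_convolution_eq h1 h2 ξ
    rw [h]
    refine h3.trans ?_
    rw [ih, fourier_salemF, smul_eq_mul]
    push_cast
    ring

lemma sinc_sq_le (x : ℝ) : Real.sinc x ^ 2 ≤ 2 * (1 + x ^ 2)⁻¹ := by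
  rw [← div_eq_mul_inv, le_div_iff₀ (by positivity)]
  have h1 : Real.sinc x ^ 2 ≤ 1 := by
    rw [sq_le_one_iff_abs_le_one]; exact Real.abs_sinc_le_one x
  have h2 : (Real.sinc x * x) ^ 2 ≤ 1 := by
    by_cases hx : x = 0
    · simp [hx]
    · rw [Real.sinc_of_ne_zero hx, div_mul_cancel₀ _ hx]
      exact Real.sin_sq_le_one x
  nlinarith

lemma sinc_pow_integrable (r : ℕ) (hr : 1 ≤ r) :
    Integrable (fun ξ : ℝ => Real.sinc (Real.pi * ξ) ^ (2 * r)) := by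
  have h : Integrable (fun ξ : ℝ => 2 * (1 + (Real.pi * ξ) ^ 2)⁻¹) :=
    (integrable_inv_one_add_sq.comp_mul_left' Real.pi_ne_zero).const_mul 2
  have hc := Real.continuous_sinc
  refine h.mono' (by fun_prop) (Filter.Eventually.of_forall fun ξ => ?_)
  rw [Real.norm_of_nonneg (by rw [pow_mul]; positivity), pow_mul]
  refine le_trans ?_ (sinc_sq_le _)
  refine pow_le_of_le_one (sq_nonneg _) ?_ (by omega)
  rw [sq_le_one_iff_abs_le_one]; exact Real.abs_sinc_le_one _

lemma salem_inversion (r : ℕ) (hr : 1 ≤ r) (y : ℝ) :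
    ∫ ξ : ℝ, Complex.exp ((2 * Real.pi * (ξ * y) : ℝ) * Complex.I) *
        ((Real.sinc (Real.pi * ξ) ^ (2 * r) : ℝ) : ℂ)
      = (convIter salemF (2 * r - 1) y : ℂ) := by
  obtain ⟨n, hn⟩ : ∃ n, 2 * r - 1 = n + 1 := ⟨2 * r - 2, by omega⟩
  have hn' : n + 1 + 1 = 2 * r := by omega
  rw [hn]
  have hF : 𝓕 (fun x => (convIter salemF (n + 1) x : ℂ)) =
      fun ξ => ((Real.sinc (Real.pi * ξ) ^ (2 * r) : ℝ) : ℂ) := by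
    ext ξ; rw [fourier_convIter, hn']
  have h := Continuous.fourierInv_fourier_eq
    (f := fun x => (convIter salemF (n + 1) x : ℂ))
    (Complex.continuous_ofReal.comp (convIter_continuous n))
    (convIter_integrable (n + 1)).ofReal
    (by rw [hF]; exact (sinc_pow_integrable r hr).ofReal)
  have h2 := congrFun h y
  rw [hF, Real.fourierInv_eq'] at h2
  rw [← h2]
  congr 1
  ext ξ
  simp [mul_comm]

lemma salem_const_pos (r : ℕ) (hr : 1 ≤ r) : 0 < convIter salemF (2 * r - 1) 0 := by
  have h := salem_inversion r hr 0
  simp only [mul_zero, Complex.ofReal_zero, zero_mul, Complex.exp_zero, one_mul] at h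
  rw [integral_complex_ofReal] at h
  have h' : ∫ ξ : ℝ, Real.sinc (Real.pi * ξ) ^ (2 * r) = convIter salemF (2 * r - 1) 0 := by
    exact_mod_cast h
  rw [← h']
  have hc := Real.continuous_sinc
  refine integral_pos_of_integrable_nonneg_nonzero (x := 0) (by fun_prop)
    (sinc_pow_integrable r hr) (fun ξ => ?_) (by simp)
  simp only [Pi.zero_apply]
  rw [pow_mul]; positivity

lemma salem_fourier (A : Finset ℝ) (Ψ : ℝ) (hΨ : 0 < Ψ) (ξ : ℝ) :
    ∫ x : ℝ, Complex.exp (-(2 * (Real.pi : ℂ) * Complex.I * (ξ : ℂ) * (x : ℂ)))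
              ∂((volume : Measure ℝ).withDensity fun x =>
                ENNReal.ofReal ((Ψ / (A.card : ℝ)) *
                  ∑ a ∈ A, Set.indicator (Set.Ico a (a + 1 / Ψ)) 1 x))
    = ((A.card : ℝ)⁻¹ * Real.sinc (Real.pi * (ξ / Ψ)) : ℝ) *
      (Complex.exp (-(2 * (Real.pi : ℂ) * Complex.I * (ξ : ℂ) * ((1 / (2 * Ψ) : ℝ) : ℂ))) *
      ∑ a ∈ A, Complex.exp (-(2 * (Real.pi : ℂ) * Complex.I * (ξ : ℂ) * (a : ℂ)))) := by
  have hm : Measurable fun x : ℝ => (Ψ / (A.card : ℝ)) *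
                  ∑ a ∈ A, Set.indicator (Set.Ico a (a + 1 / Ψ)) (1 : ℝ → ℝ) x := by
    refine Measurable.const_mul (Finset.measurable_sum _ fun a _ => ?_) _
    exact measurable_one.indicator measurableSet_Ico
  have hnn : ∀ x : ℝ, 0 ≤ (Ψ / (A.card : ℝ)) *
                  ∑ a ∈ A, Set.indicator (Set.Ico a (a + 1 / Ψ)) (1 : ℝ → ℝ) x := fun x =>
    mul_nonneg (by positivity) (Finset.sum_nonneg fun a _ =>
      Set.indicator_nonneg (fun _ _ => zero_le_one) x)
  rw [integral_withDensity_eq_integral_toReal_smul hm.ennreal_ofReal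
    (Filter.Eventually.of_forall fun _ => ENNReal.ofReal_lt_top)]
  have h1 : ∀ x : ℝ, (ENNReal.ofReal ((Ψ / (A.card : ℝ)) *
                  ∑ a ∈ A, Set.indicator (Set.Ico a (a + 1 / Ψ)) (1 : ℝ → ℝ) x)).toReal •
        Complex.exp (-(2 * (Real.pi : ℂ) * Complex.I * (ξ : ℂ) * (x : ℂ)))
      = ((Ψ / A.card : ℝ) : ℂ) * ∑ a ∈ A, Set.indicator (Set.Ico a (a + 1 / Ψ)) (fun x : ℝ =>
        Complex.exp (-(2 * (Real.pi : ℂ) * Complex.I * (ξ : ℂ) * (x : ℂ)))) x := by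
    intro x
    rw [ENNReal.toReal_ofReal (hnn x), Complex.real_smul, Complex.ofReal_mul, mul_assoc,
      Complex.ofReal_sum, Finset.sum_mul]
    congr 1
    refine Finset.sum_congr rfl fun a _ => ?_
    by_cases hx : x ∈ Set.Ico a (a + 1 / Ψ)
    · rw [Set.indicator_of_mem hx, Set.indicator_of_mem hx]; simp
    · rw [Set.indicator_of_notMem hx, Set.indicator_of_notMem hx]; simp
  simp_rw [h1]
  have hΨ' : (Ψ : ℂ) ≠ 0 := by exact_mod_cast hΨ.ne'
  rw [integral_const_mul, integral_finsetSum]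
  · rw [Finset.mul_sum, Finset.mul_sum, Finset.mul_sum]
    refine Finset.sum_congr rfl fun a _ => ?_
    have h := exp_integral (a + 1 / (2 * Ψ)) (1 / (2 * Ψ)) ξ
    rw [integral_indicator measurableSet_Ico, integral_Ico_eq_integral_Ioc,
      ← intervalIntegral.integral_of_le (by simp [hΨ.le])]
    rw [show a + 1 / (2 * Ψ) - 1 / (2 * Ψ) = a by ring,
      show a + 1 / (2 * Ψ) + 1 / (2 * Ψ) = a + 1 / Ψ by field_simp; ring] at h
    rw [h, show 2 * Real.pi * ξ * (1 / (2 * Ψ)) = Real.pi * (ξ / Ψ) by field_simp]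
    rw [← Complex.exp_add,
      show -(2 * (Real.pi : ℂ) * Complex.I * (ξ : ℂ) * ((1 / (2 * Ψ) : ℝ) : ℂ)) +
        -(2 * (Real.pi : ℂ) * Complex.I * (ξ : ℂ) * (a : ℂ)) =
        -(2 * (Real.pi : ℂ) * Complex.I * (ξ : ℂ) * ((a + 1 / (2 * Ψ) : ℝ) : ℂ)) by
        push_cast; ring]
    push_cast
    field_simp
  · intro a _
    rw [integrable_indicator_iff measurableSet_Ico]
    refine (Continuous.integrableOn_Icc (a := a) (b := a + 1 / Ψ) (by fun_prop)).mono_set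
      Set.Ico_subset_Icc_self

lemma norm_pow_expand (A : Finset ℝ) (r : ℕ) (ξ : ℝ) :
    ((‖∑ a ∈ A, Complex.exp (-(2 * (Real.pi : ℂ) * Complex.I * (ξ : ℂ) * (a : ℂ)))‖ ^ (2 * r) : ℝ)
      : ℂ) =
    ∑ p ∈ (Fintype.piFinset fun _ : Fin r => A) ×ˢ (Fintype.piFinset fun _ : Fin r => A),
      Complex.exp ((2 * Real.pi * (ξ * (∑ i, p.2 i - ∑ i, p.1 i)) : ℝ) * Complex.I) := by
  rw [pow_mul, Complex.ofReal_pow, Complex.ofReal_pow, ← Complex.mul_conj', mul_pow, map_sum,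
    Finset.sum_pow', Finset.sum_pow', Finset.sum_mul_sum, ← Finset.sum_product']
  refine Finset.sum_congr rfl fun p _ => ?_
  simp_rw [← Complex.exp_conj]
  rw [← Complex.exp_sum, ← Complex.exp_sum, ← Complex.exp_add]
  congr 1
  simp only [map_neg, map_mul, Complex.conj_I, Complex.conj_ofReal, map_ofNat]
  push_cast
  simp only [Finset.sum_neg_distrib, ← Finset.mul_sum]
  ring

lemma salem_integral (A : Finset ℝ) (Ψ : ℝ) (hΨ : 0 < Ψ) (r : ℕ) (hr : 1 ≤ r) :
    ∫ ξ : ℝ, Real.sinc (Real.pi * (ξ / Ψ)) ^ (2 * r) *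
      ‖∑ a ∈ A, Complex.exp (-(2 * (Real.pi : ℂ) * Complex.I * (ξ : ℂ) * (a : ℂ)))‖ ^ (2 * r)
    = ∑ p ∈ (Fintype.piFinset fun _ : Fin r => A) ×ˢ (Fintype.piFinset fun _ : Fin r => A),
      Ψ * convIter salemF (2 * r - 1) (Ψ * (∑ i, p.2 i - ∑ i, p.1 i)) := by
  have hs : Integrable (fun ξ : ℝ => Real.sinc (Real.pi * (ξ / Ψ)) ^ (2 * r)) :=
    (sinc_pow_integrable r hr).comp_div hΨ.ne'
  rw [← Complex.ofReal_inj, ← integral_complex_ofReal]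
  simp_rw [Complex.ofReal_mul _ (‖_‖ ^ _), norm_pow_expand, Finset.mul_sum]
  rw [integral_finsetSum]
  · rw [Complex.ofReal_sum]
    refine Finset.sum_congr rfl fun p _ => ?_
    rw [Complex.ofReal_mul, ← salem_inversion r hr, ← abs_of_pos hΨ, ← Complex.real_smul,
      abs_of_pos hΨ]
    have := MeasureTheory.Measure.integral_comp_div (fun ξ : ℝ =>
      Complex.exp ((2 * Real.pi * (ξ * (Ψ * (∑ i, p.2 i - ∑ i, p.1 i))) : ℝ) * Complex.I) *
        ((Real.sinc (Real.pi * ξ) ^ (2 * r) : ℝ) : ℂ)) Ψ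
    rw [abs_of_pos hΨ] at this
    rw [← this]
    congr 1
    ext ξ
    rw [mul_comm]
    congr 5
    field_simp
  · intro p _
    refine Integrable.mul_bdd (c := 1) hs.ofReal (by fun_prop) ?_
    refine Filter.Eventually.of_forall fun ξ => ?_
    rw [Complex.norm_exp_ofReal_mul_I]

/-- **Salem's trick.** Let `A ⊆ ℝ` be a finite nonempty set with `T = #A`, `Ψ > 0`, `r ≥ 1`,
and let `ν` be the probability measure with density `(Ψ/T) ∑_{a ∈ A} 1_{[a, a+1/Ψ)}`.
Then `∫ |ν̂(ξ)|^{2r} dξ ≥ C_r (Ψ / T^{2r}) M_r`, where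
`C_r = (1_{[-1/2,1/2)})^{*2r}(0) > 0` and `M_r` is the number of `2r`-tuples from `A`
with `a₁ + ⋯ + a_r = a_{r+1} + ⋯ + a_{2r}`. -/
theorem salem_trick_lower_bound (A : Finset ℝ) (hA : A.Nonempty)
    (Ψ : ℝ) (hΨ : 0 < Ψ) (r : ℕ) (hr : 1 ≤ r) :
    0 < convIter (Set.indicator (Set.Ico (-(1 : ℝ) / 2) (1 / 2)) 1) (2 * r - 1) 0 ∧
    ENNReal.ofReal
        (convIter (Set.indicator (Set.Ico (-(1 : ℝ) / 2) (1 / 2)) 1) (2 * r - 1) 0 *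
          (Ψ / (A.card : ℝ) ^ (2 * r)) *
          ((Finset.filter (fun p : (Fin r → ℝ) × (Fin r → ℝ) => ∑ i, p.1 i = ∑ i, p.2 i)
            ((Fintype.piFinset fun _ : Fin r => A) ×ˢ (Fintype.piFinset fun _ : Fin r => A))).card))
      ≤ ∫⁻ ξ : ℝ,
          (‖∫ x : ℝ, Complex.exp (-(2 * (Real.pi : ℂ) * Complex.I * (ξ : ℂ) * (x : ℂ)))
              ∂((volume : Measure ℝ).withDensity fun x =>
                ENNReal.ofReal ((Ψ / (A.card : ℝ)) *
                  ∑ a ∈ A, Set.indicator (Set.Ico a (a + 1 / Ψ)) 1 x))‖₊ : ENNReal) ^ (2 * r) := by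

  change 0 < convIter salemF (2 * r - 1) 0 ∧ ENNReal.ofReal (convIter salemF (2 * r - 1) 0 *
    _ * _) ≤ _
  refine ⟨salem_const_pos r hr, ?_⟩
  have hT : (0 : ℝ) < A.card := by exact_mod_cast hA.card_pos
  have hnorm : ∀ ξ : ℝ, (‖∫ x : ℝ, Complex.exp (-(2 * (Real.pi : ℂ) * Complex.I * (ξ : ℂ) * (x : ℂ)))
              ∂((volume : Measure ℝ).withDensity fun x =>
                ENNReal.ofReal ((Ψ / (A.card : ℝ)) *
                  ∑ a ∈ A, Set.indicator (Set.Ico a (a + 1 / Ψ)) 1 x))‖₊ : ENNReal) ^ (2 * r)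
      = ENNReal.ofReal (((A.card : ℝ) ^ (2 * r))⁻¹ * (Real.sinc (Real.pi * (ξ / Ψ)) ^ (2 * r) *
      ‖∑ a ∈ A, Complex.exp (-(2 * (Real.pi : ℂ) * Complex.I * (ξ : ℂ) * (a : ℂ)))‖ ^ (2 * r))) := by
    intro ξ
    rw [salem_fourier A Ψ hΨ ξ, ← enorm_eq_nnnorm, ← ofReal_norm, ← ENNReal.ofReal_pow (norm_nonneg _)]
    congr 1
    have h1 : ‖Complex.exp (-(2 * (Real.pi : ℂ) * Complex.I * (ξ : ℂ) * ((1 / (2 * Ψ) : ℝ) : ℂ)))‖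
        = 1 := by
      rw [show -(2 * (Real.pi : ℂ) * Complex.I * (ξ : ℂ) * ((1 / (2 * Ψ) : ℝ) : ℂ)) =
        ((-(2 * Real.pi * ξ * (1 / (2 * Ψ))) : ℝ) : ℂ) * Complex.I by push_cast; ring,
        Complex.norm_exp_ofReal_mul_I]
    rw [norm_mul, norm_mul, h1, one_mul, Complex.norm_real, mul_pow, Real.norm_eq_abs,
      pow_mul |_|, sq_abs, ← pow_mul, mul_pow, inv_pow, mul_assoc]
  simp_rw [hnorm]
  have hs : Integrable (fun ξ : ℝ => Real.sinc (Real.pi * (ξ / Ψ)) ^ (2 * r)) :=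
    (sinc_pow_integrable r hr).comp_div hΨ.ne'
  rw [← ofReal_integral_eq_lintegral_ofReal]
  · refine ENNReal.ofReal_le_ofReal ?_
    rw [integral_const_mul, salem_integral A Ψ hΨ r hr, Finset.card_filter, Nat.cast_sum,
      Finset.mul_sum, Finset.mul_sum]
    refine Finset.sum_le_sum fun p _ => ?_
    have h0 := convIter_nonneg (2 * r - 1) (Ψ * (∑ i, p.2 i - ∑ i, p.1 i))
    split_ifs with h
    · rw [h]
      simp only [sub_self, mul_zero, Nat.cast_one, mul_one]
      apply le_of_eq
      ring
    · simp only [Nat.cast_zero, mul_zero]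
      positivity
  · refine Integrable.const_mul ?_ _
    refine Integrable.mul_bdd (c := (A.card : ℝ) ^ (2 * r)) hs (by fun_prop) ?_
    refine Filter.Eventually.of_forall fun ξ => ?_
    rw [norm_pow, norm_norm]
    refine pow_le_pow_left₀ (norm_nonneg _) ?_ _
    refine (norm_sum_le _ _).trans ?_
    refine (Finset.sum_le_card_nsmul _ _ 1 fun a _ => ?_).trans (by simp)
    rw [show -(2 * (Real.pi : ℂ) * Complex.I * (ξ : ℂ) * (a : ℂ)) =
        ((-(2 * Real.pi * ξ * a) : ℝ) : ℂ) * Complex.I by push_cast; ring,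
        Complex.norm_exp_ofReal_mul_I]
  · refine Filter.Eventually.of_forall fun ξ => ?_
    simp only [Pi.zero_apply]
    rw [pow_mul (Real.sinc _)]
    positivity
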